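/- arXiv:2604.11157 — 6 statements merged into one kernel-verified Lean document; each statement's English description precedes it below -/
import Mathlib

section
/- Let λ : ℕ → ℝ satisfy 0 < λ n for every n, and let a : ℕ → ℂ satisfy Summable (fun n => ‖a n‖). Define f : ℝ → ℂ by f t = ∑' n, a n * Complex.exp (-(λ n) * t). Then f is real-analytic on the open half-line (0, ∞), i.e., AnalyticOnNhd ℝ f (Set.Ioi 0). -/
/-- A generalized Dirichlet series with nonnegative exponents and absolutely summable coefficients
is holomorphic on the open right half-plane. -/
theorem differentiableOn_tsum_mul_exp_neg_mul {ι : Type*} {lam : ι → ℝ} (hlam : ∀ i, 0 ≤ lam i)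
    {a : ι → ℂ} (ha : Summable (fun i => ‖a i‖)) :
    DifferentiableOn ℂ (fun z : ℂ => ∑' i, a i * Complex.exp (-(lam i : ℂ) * z))
      {z : ℂ | 0 < z.re} := by
  refine Complex.differentiableOn_tsum_of_summable_norm ha (fun i => by fun_prop)
    (isOpen_lt continuous_const Complex.continuous_re) fun i z hz => ?_
  rw [norm_mul, Complex.norm_exp]
  refine mul_le_of_le_one_right (norm_nonneg _) (Real.exp_le_one_iff.2 ?_)
  simpa using mul_nonneg (hlam i) (le_of_lt hz)

theorem dirichlet_series_analyticOnNhd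
    (lam : ℕ → ℝ) (hlam : ∀ n, 0 < lam n)
    (a : ℕ → ℂ) (ha : Summable (fun n => ‖a n‖)) :
    AnalyticOnNhd ℝ
      (fun t : ℝ => ∑' n, a n * Complex.exp (-(lam n : ℂ) * (t : ℂ)))
      (Set.Ioi (0 : ℝ)) := by
  have h := ((differentiableOn_tsum_mul_exp_neg_mul (fun n => (hlam n).le) ha).analyticOnNhd
    (isOpen_lt continuous_const Complex.continuous_re)).restrictScalars (𝕜 := ℝ)
  exact h.comp (Complex.ofRealCLM.analyticOnNhd _) fun t ht => by simpa using ht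
end

section
/- Let λ : ℕ → ℝ satisfy 0 < λ n for every n, and let a : ℕ → ℂ satisfy Summable (fun n => ‖a n‖). Define F : ℝ → ℂ by F t = ∑' n, a n * (1 - Complex.exp (-(λ n) * t)). If there exist real numbers 0 ≤ t₁ < t̃₁ such that F t = 0 for all t in the open interval (t₁, t̃₁), then F t = 0 for all t > 0. -/
/-- On the open right half plane, an absolutely summable combination of the functions
`z ↦ 1 - exp (-lam n * z)` with nonnegative rates is holomorphic. -/
lemma differentiableOn_tsum_mul_one_sub_exp {ι : Type*}
    (lam : ι → ℝ) (hlam : ∀ n, 0 ≤ lam n)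
    (a : ι → ℂ) (ha : Summable (fun n => ‖a n‖)) :
    DifferentiableOn ℂ (fun z : ℂ => ∑' n, a n * (1 - Complex.exp (-(lam n : ℂ) * z)))
      {z : ℂ | 0 < z.re} := by
  refine Complex.differentiableOn_tsum_of_summable_norm (ha.mul_right 2)
    (fun n => by fun_prop) (isOpen_lt continuous_const Complex.continuous_re) ?_
  intro n z hz
  rw [norm_mul]
  gcongr
  have hexp : ‖Complex.exp (-(lam n : ℂ) * z)‖ ≤ 1 := by
    rw [Complex.norm_exp, Real.exp_le_one_iff]
    simpa using mul_nonneg (hlam n) (le_of_lt hz)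
  calc ‖1 - Complex.exp (-(lam n : ℂ) * z)‖
      ≤ ‖(1 : ℂ)‖ + ‖Complex.exp (-(lam n : ℂ) * z)‖ := norm_sub_le _ _
    _ ≤ 2 := by rw [norm_one]; linarith

theorem flux_series_unique_extension
    (lam : ℕ → ℝ) (hlam : ∀ n, 0 < lam n)
    (a : ℕ → ℂ) (ha : Summable (fun n => ‖a n‖))
    (F : ℝ → ℂ)
    (hF : ∀ t : ℝ, F t = ∑' n, a n * (1 - Complex.exp (-(lam n : ℂ) * (t : ℂ))))
    (t₁ t₁' : ℝ) (ht₁ : 0 ≤ t₁) (ht : t₁ < t₁')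
    (hzero : ∀ t ∈ Set.Ioo t₁ t₁', F t = 0) :
    ∀ t : ℝ, 0 < t → F t = 0 := by
  have hG := (differentiableOn_tsum_mul_one_sub_exp lam (fun n => (hlam n).le) a ha).analyticOnNhd
    (isOpen_lt continuous_const Complex.continuous_re)
  have hFan : AnalyticOnNhd ℝ F (Set.Ioi 0) := by
    rw [funext hF]
    exact (hG.restrictScalars (𝕜 := ℝ)).comp (fun t _ => Complex.ofRealCLM.analyticAt t)
      (fun t ht => by simpa using ht)
  obtain ⟨s, hs⟩ := Set.nonempty_Ioo.2 ht
  exact hFan.eqOn_zero_of_preconnected_of_eventuallyEq_zero isPreconnected_Ioi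
    (ht₁.trans_lt hs.1) (Filter.eventually_of_mem (Ioo_mem_nhds hs.1 hs.2) hzero)
end

section
/- Let λ : ℕ → ℝ be strictly monotone increasing with 0 < λ 0, and let a : ℕ → ℂ satisfy Summable (fun n => ‖a n‖). If ∑' n, a n * Complex.exp (-(λ n) * t) = 0 for every real t > 0, then a n = 0 for every n. -/
theorem exp_series_linear_independence
    (lam : ℕ → ℝ) (hmono : StrictMono lam) (hpos : 0 < lam 0)
    (a : ℕ → ℂ) (ha : Summable (fun n => ‖a n‖))
    (hzero : ∀ t : ℝ, 0 < t →
      ∑' n, a n * Complex.exp (-(lam n : ℂ) * (t : ℂ)) = 0) :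
    ∀ n, a n = 0 := by
  intro n
  induction n using Nat.strong_induction_on with
  | _ n ih =>
  have norm_term (k : ℕ) (t : ℝ) :
      ‖a k * Complex.exp (((lam n - lam k) * t : ℝ) : ℂ)‖
        = ‖a k‖ * Real.exp ((lam n - lam k) * t) := by
    rw [norm_mul, Complex.norm_exp_ofReal]
  -- Factoring out the slowest remaining exponential isolates `a n` as `t → ∞`.
  have hlim : Filter.Tendsto
      (fun t : ℝ => ∑' k, a k * Complex.exp (((lam n - lam k) * t : ℝ) : ℂ))
      Filter.atTop (nhds (∑' k, if k = n then a n else 0)) := by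
    refine tendsto_tsum_of_dominated_convergence ha (fun k => ?_) ?_
    · rcases lt_trichotomy k n with hk | rfl | hk
      · simp [ih k hk, hk.ne]
      · simp
      · rw [if_neg hk.ne', tendsto_zero_iff_norm_tendsto_zero]
        simp only [norm_term]
        rw [← mul_zero ‖a k‖]
        exact (Real.tendsto_exp_atBot.comp (Filter.tendsto_id.const_mul_atTop_of_neg
          (sub_neg.2 (hmono hk)))).const_mul _
    · filter_upwards [Filter.eventually_ge_atTop 0] with t ht k
      rcases lt_or_ge k n with hk | hk
      · simp [ih k hk]
      · rw [norm_term]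
        exact mul_le_of_le_one_right (norm_nonneg _) (Real.exp_le_one_iff.2
          (mul_nonpos_of_nonpos_of_nonneg (sub_nonpos.2 (hmono.monotone hk)) ht))
  rw [tsum_ite_eq] at hlim
  refine tendsto_nhds_unique hlim (tendsto_const_nhds.congr' ?_)
  filter_upwards [Filter.eventually_gt_atTop 0] with t ht
  rw [← mul_zero (Complex.exp (lam n * t)), ← hzero t ht, ← tsum_mul_left]
  refine tsum_congr fun k => ?_
  rw [mul_left_comm, ← Complex.exp_add]
  push_cast
  ring_nf
end

section
/- Let λ : ℕ → ℝ be strictly monotone increasing with 0 < λ 0, and let a : ℕ → ℂ satisfy Summable (fun n => ‖a n‖). If ∑' n, a n * (1 - Complex.exp (-(λ n) * t)) = 0 for every real t > 0, then a n = 0 for every n. -/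
open Filter Topology in
/-- As `t → ∞`, a Dirichlet-type series with nonnegative exponents on the support of its absolutely
summable coefficients converges to the sum of the coefficients with zero exponent. -/
theorem tendsto_tsum_mul_exp_neg_mul_atTop {ι : Type*} {a : ι → ℂ} {μ : ι → ℝ}
    (ha : Summable fun n => ‖a n‖) (hμ : ∀ n, a n ≠ 0 → 0 ≤ μ n) :
    Tendsto (fun t : ℝ => ∑' n, a n * Complex.exp (-(μ n : ℂ) * t)) atTop
      (𝓝 (∑' n, if μ n = 0 then a n else 0)) := by
  have hnorm (n : ι) (t : ℝ) : ‖Complex.exp (-(μ n : ℂ) * t)‖ = Real.exp (-(μ n * t)) := by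
    simp [Complex.norm_exp]
  refine tendsto_tsum_of_dominated_convergence ha (fun n => ?_) ?_
  · by_cases han : a n = 0
    · simp [han]
    split_ifs with h0
    · simp [h0]
    · have hn : 0 < μ n := lt_of_le_of_ne (hμ n han) (Ne.symm h0)
      have hexp : Tendsto (fun t : ℝ => Complex.exp (-(μ n : ℂ) * t)) atTop (𝓝 0) := by
        rw [tendsto_zero_iff_norm_tendsto_zero]
        simp_rw [hnorm]
        exact Real.tendsto_exp_neg_atTop_nhds_zero.comp (tendsto_id.const_mul_atTop hn)
      simpa using hexp.const_mul (a n)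
  · filter_upwards [eventually_ge_atTop 0] with t ht n
    by_cases han : a n = 0
    · simp [han]
    rw [norm_mul, hnorm]
    refine mul_le_of_le_one_right (norm_nonneg _) (Real.exp_le_one_iff.2 ?_)
    exact neg_nonpos.2 (mul_nonneg (hμ n han) ht)

theorem Summable.mul_exp_neg_mul {ι : Type*} {a : ι → ℂ} {μ : ι → ℝ}
    (ha : Summable fun n => ‖a n‖) (hμ : ∀ n, 0 ≤ μ n) {t : ℝ} (ht : 0 ≤ t) :
    Summable fun n => a n * Complex.exp (-(μ n : ℂ) * t) := by
  refine ha.of_norm_bounded fun n => ?_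
  rw [norm_mul]
  refine mul_le_of_le_one_right (norm_nonneg _) ?_
  simpa [Complex.norm_exp] using mul_nonneg (hμ n) ht

open Filter Topology in
theorem eq_zero_of_tsum_mul_exp_neg_mul_eq_zero {lam : ℕ → ℝ} (hmono : StrictMono lam)
    {a : ℕ → ℂ} (ha : Summable fun n => ‖a n‖)
    (hzero : ∀ t : ℝ, 0 < t → ∑' n, a n * Complex.exp (-(lam n : ℂ) * t) = 0) (m : ℕ) :
    a m = 0 := by
  induction m using Nat.strong_induction_on with
  | _ m ih =>
    have hlim := tendsto_tsum_mul_exp_neg_mul_atTop (μ := fun n => lam n - lam m) ha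
      fun n hn => sub_nonneg.2 <| hmono.monotone <| not_lt.1 fun h => hn (ih n h)
    simp only [sub_eq_zero, hmono.injective.eq_iff, tsum_ite_eq] at hlim
    refine tendsto_nhds_unique_of_eventuallyEq hlim (tendsto_const_nhds (x := (0 : ℂ))) ?_
    filter_upwards [eventually_gt_atTop 0] with t ht
    have hfactor (n : ℕ) : a n * Complex.exp (-((lam n - lam m : ℝ) : ℂ) * t) =
        a n * Complex.exp (-(lam n : ℂ) * t) * Complex.exp (lam m * t) := by
      rw [mul_assoc, ← Complex.exp_add]
      push_cast
      ring_nf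
    simp_rw [hfactor]
    rw [tsum_mul_right, hzero t ht, zero_mul]

theorem flux_series_linear_independence
    (lam : ℕ → ℝ) (hmono : StrictMono lam) (hpos : 0 < lam 0)
    (a : ℕ → ℂ) (ha : Summable (fun n => ‖a n‖))
    (hzero : ∀ t : ℝ, 0 < t →
      ∑' n, a n * (1 - Complex.exp (-(lam n : ℂ) * (t : ℂ))) = 0) :
    ∀ n, a n = 0 := by
  have hlam (n : ℕ) : 0 < lam n := hpos.trans_le (hmono.monotone n.zero_le)
  have hconst (t : ℝ) (ht : 0 < t) :
      ∑' n, a n * Complex.exp (-(lam n : ℂ) * t) = ∑' n, a n := by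
    have h := hzero t ht
    simp_rw [mul_sub, mul_one] at h
    rw [ha.of_norm.tsum_sub (ha.mul_exp_neg_mul (fun n => (hlam n).le) ht.le)] at h
    exact (sub_eq_zero.1 h).symm
  have hsum : ∑' n, a n = 0 := by
    have hlim := tendsto_tsum_mul_exp_neg_mul_atTop ha fun n _ => (hlam n).le
    simp only [(hlam _).ne', if_false, tsum_zero] at hlim
    refine tendsto_nhds_unique_of_eventuallyEq tendsto_const_nhds hlim ?_
    filter_upwards [Filter.eventually_gt_atTop 0] with t ht
    exact (hconst t ht).symm
  exact eq_zero_of_tsum_mul_exp_neg_mul_eq_zero hmono ha fun t ht => (hconst t ht).trans hsum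
end

section
/- Let λ : ℕ → ℝ be strictly monotone increasing with 0 < λ 0, let m : ℕ → ℕ, and let a, b : ℕ → ℂ satisfy Summable (fun k => ‖a k‖) and Summable (fun k => ‖b k‖), with b k = 0 whenever m k = 0. Let θ₁, θ₂ : ℝ with (θ₁ - θ₂)/π irrational. Suppose that for every real t > 0 and for each j ∈ {1, 2}: ∑' k, (a k * Complex.exp (-Complex.I * (m k) * θ_j) + b k * Complex.exp (Complex.I * (m k) * θ_j)) * (1 - Complex.exp (-(λ k) * t)) = 0. Then a k = 0 and b k = 0 for every k. -/
open Filter Topology in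
/-- The series `∑ c k * exp (-μ k * t)` tends to `0` as `t → ∞` when `c` is absolutely summable and
`0 < μ k` wherever `c k ≠ 0`. -/
theorem tendsto_tsum_mul_exp_neg_atTop {c : ℕ → ℂ} (hc : Summable fun k => ‖c k‖) {μ : ℕ → ℝ}
    (hμ : ∀ k, c k ≠ 0 → 0 < μ k) :
    Tendsto (fun t : ℝ => ∑' k, c k * Complex.exp (-(μ k : ℂ) * (t : ℂ))) atTop (𝓝 0) := by
  have norm_exp (k : ℕ) (t : ℝ) :
      ‖Complex.exp (-(μ k : ℂ) * (t : ℂ))‖ = Real.exp (-(μ k * t)) := by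
    simp [Complex.norm_exp]
  rw [← tsum_zero (α := ℂ) (β := ℕ)]
  refine tendsto_tsum_of_dominated_convergence hc (fun k => ?_) ?_
  · by_cases hk : c k = 0
    · simp [hk]
    · rw [tendsto_zero_iff_norm_tendsto_zero]
      simp only [norm_mul, norm_exp]
      simpa using (Real.tendsto_exp_neg_atTop_nhds_zero.comp
        (tendsto_id.const_mul_atTop (hμ k hk))).const_mul ‖c k‖
  · filter_upwards [eventually_ge_atTop 0] with t ht k
    by_cases hk : c k = 0
    · simp [hk]
    · rw [norm_mul, norm_exp]
      refine mul_le_of_le_one_right (norm_nonneg _) (Real.exp_le_one_iff.2 ?_)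
      have := mul_nonneg (hμ k hk).le ht
      linarith

/-- Uniqueness of coefficients of an absolutely summable Dirichlet series. -/
theorem eq_zero_of_tsum_mul_exp_neg_eq_zero {c : ℕ → ℂ} (hc : Summable fun k => ‖c k‖)
    {lam : ℕ → ℝ} (hmono : StrictMono lam)
    (h : ∀ t : ℝ, 0 < t → ∑' k, c k * Complex.exp (-(lam k : ℂ) * (t : ℂ)) = 0) (n : ℕ) :
    c n = 0 := by
  induction n using Nat.strong_induction_on with
  | _ n ih =>
  have hd : Summable fun k => ‖Function.update c n 0 k‖ := by
    refine hc.of_nonneg_of_le (fun _ => norm_nonneg _) fun k => ?_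
    by_cases hk : k = n <;> simp [hk]
  have hlim := tendsto_tsum_mul_exp_neg_atTop hd (μ := fun k => lam k - lam n) fun k hk => by
    have hkn : k ≠ n := by rintro rfl; simp at hk
    rw [Function.update_of_ne hkn] at hk
    have : n < k := by
      by_contra! hle
      exact hk (ih k (lt_of_le_of_ne hle hkn))
    exact sub_pos.2 (hmono this)
  have hconst : ∀ t : ℝ, 0 < t → ∑' k, Function.update c n 0 k *
      Complex.exp (-((lam k - lam n : ℝ) : ℂ) * (t : ℂ)) = -c n := by
    intro t ht
    have hterm (k : ℕ) : c k * Complex.exp (-((lam k - lam n : ℝ) : ℂ) * (t : ℂ)) =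
        Complex.exp ((lam n : ℂ) * t) * (c k * Complex.exp (-(lam k : ℂ) * (t : ℂ))) := by
      rw [mul_left_comm, ← Complex.exp_add]
      push_cast
      ring_nf
    have hfull : ∑' k, c k * Complex.exp (-((lam k - lam n : ℝ) : ℂ) * (t : ℂ)) = 0 := by
      simp_rw [hterm, tsum_mul_left, h t ht, mul_zero]
    have hsum : Summable fun k => Function.update c n 0 k *
        Complex.exp (-((lam k - lam n : ℝ) : ℂ) * (t : ℂ)) := by
      refine Summable.of_norm_bounded hd fun k => ?_
      rcases lt_trichotomy k n with hk | rfl | hk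
      · simp [Function.update_of_ne hk.ne, ih k hk]
      · simp
      · rw [norm_mul]
        refine mul_le_of_le_one_right (norm_nonneg _) ?_
        have := mul_pos (sub_pos.2 (hmono hk)) ht
        rw [Complex.norm_exp, Real.exp_le_one_iff]
        simp only [Complex.mul_re, Complex.neg_re, Complex.ofReal_re, Complex.ofReal_im, mul_zero]
        linarith
    have hsplit (k : ℕ) : c k * Complex.exp (-((lam k - lam n : ℝ) : ℂ) * (t : ℂ)) =
        Function.update c n 0 k * Complex.exp (-((lam k - lam n : ℝ) : ℂ) * (t : ℂ)) +
          if k = n then c n else 0 := by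
      by_cases hk : k = n
      · subst hk; simp
      · simp [hk]
    simp_rw [hsplit] at hfull
    rw [hsum.tsum_add (hasSum_ite_eq n (c n)).summable, tsum_ite_eq] at hfull
    exact eq_neg_of_add_eq_zero_left hfull
  have := tendsto_nhds_unique (hlim.congr' <| by
    filter_upwards [Filter.eventually_gt_atTop 0] with t ht using hconst t ht) tendsto_const_nhds
  simpa using this.symm

/-- Uniqueness of coefficients for series in the functions `1 - exp (-lam k * t)`. -/
theorem eq_zero_of_tsum_mul_one_sub_exp_neg_eq_zero {c : ℕ → ℂ} (hc : Summable fun k => ‖c k‖)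
    {lam : ℕ → ℝ} (hmono : StrictMono lam) (hpos : 0 < lam 0)
    (h : ∀ t : ℝ, 0 < t → ∑' k, c k * (1 - Complex.exp (-(lam k : ℂ) * (t : ℂ))) = 0) (n : ℕ) :
    c n = 0 := by
  have hlam (k : ℕ) : 0 < lam k := hpos.trans_le (hmono.monotone k.zero_le)
  have heq : ∀ t : ℝ, 0 < t →
      ∑' k, c k * Complex.exp (-(lam k : ℂ) * (t : ℂ)) = ∑' k, c k := by
    intro t ht
    have hsum : Summable fun k => c k * Complex.exp (-(lam k : ℂ) * (t : ℂ)) := by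
      refine Summable.of_norm_bounded hc fun k => ?_
      rw [norm_mul]
      refine mul_le_of_le_one_right (norm_nonneg _) ?_
      rw [Complex.norm_exp, Real.exp_le_one_iff]
      simpa using (mul_pos (hlam k) ht).le
    have h0 := h t ht
    simp_rw [mul_sub, mul_one] at h0
    rw [hc.of_norm.tsum_sub hsum] at h0
    exact (sub_eq_zero.1 h0).symm
  have hzero : ∑' k, c k = 0 :=
    tendsto_nhds_unique tendsto_const_nhds <|
      (tendsto_tsum_mul_exp_neg_atTop hc fun k _ => hlam k).congr' <| by
        filter_upwards [Filter.eventually_gt_atTop 0] with t ht using heq t ht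
  exact eq_zero_of_tsum_mul_exp_neg_eq_zero hc hmono (fun t ht => (heq t ht).trans hzero) n

theorem summable_norm_angular_coeff {a b : ℕ → ℂ} (ha : Summable fun k => ‖a k‖)
    (hb : Summable fun k => ‖b k‖) (m : ℕ → ℕ) (θ : ℝ) :
    Summable fun k => ‖a k * Complex.exp (-Complex.I * (m k : ℂ) * (θ : ℂ)) +
      b k * Complex.exp (Complex.I * (m k : ℂ) * (θ : ℂ))‖ := by
  refine (ha.add hb).of_nonneg_of_le (fun _ => norm_nonneg _) fun k => ?_
  refine (norm_add_le _ _).trans_eq ?_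
  simp [Complex.norm_exp]

/-- Two angles whose difference is not a rational multiple of `π` separate `exp (± I * m * θ)`. -/
theorem eq_zero_of_angular_coeff_eq_zero {a b : ℂ} {m : ℕ} (hm : m ≠ 0) {θ₁ θ₂ : ℝ}
    (hirr : Irrational ((θ₁ - θ₂) / Real.pi))
    (h1 : a * Complex.exp (-Complex.I * (m : ℂ) * (θ₁ : ℂ)) +
      b * Complex.exp (Complex.I * (m : ℂ) * (θ₁ : ℂ)) = 0)
    (h2 : a * Complex.exp (-Complex.I * (m : ℂ) * (θ₂ : ℂ)) +
      b * Complex.exp (Complex.I * (m : ℂ) * (θ₂ : ℂ)) = 0) :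
    a = 0 ∧ b = 0 := by
  have key (θ : ℝ) (h : a * Complex.exp (-Complex.I * (m : ℂ) * (θ : ℂ)) +
      b * Complex.exp (Complex.I * (m : ℂ) * (θ : ℂ)) = 0) :
      a = -(b * Complex.exp (2 * Complex.I * m * θ)) := by
    have h' := congrArg (· * Complex.exp (Complex.I * m * θ)) h
    simp only [add_mul, mul_assoc, ← Complex.exp_add, zero_mul] at h'
    ring_nf at h' ⊢
    simp only [Complex.exp_zero, mul_one] at h'
    linear_combination h'
  have hb : b = 0 := by
    by_contra hb
    have h := (key θ₁ h1).symm.trans (key θ₂ h2)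
    rw [neg_inj, mul_right_inj' hb, Complex.exp_eq_exp_iff_exists_int] at h
    obtain ⟨n, hn⟩ := h
    have hreal : (m : ℝ) * (θ₁ - θ₂) = n * Real.pi := by
      have : (m : ℂ) * (θ₁ - θ₂) = n * Real.pi := by
        apply mul_left_cancel₀ Complex.two_pi_I_ne_zero
        linear_combination (Real.pi : ℂ) * hn
      exact_mod_cast this
    refine hirr ⟨n / m, ?_⟩
    have hm' : (m : ℝ) ≠ 0 := Nat.cast_ne_zero.2 hm
    push_cast
    rw [div_eq_div_iff hm' Real.pi_ne_zero]
    linarith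
  exact ⟨by simpa [hb] using key θ₁ h1, hb⟩

theorem two_angle_flux_vanishing_all_times
    (lam : ℕ → ℝ) (hmono : StrictMono lam) (hpos : 0 < lam 0)
    (m : ℕ → ℕ) (a b : ℕ → ℂ)
    (ha : Summable (fun k => ‖a k‖)) (hb : Summable (fun k => ‖b k‖))
    (hb0 : ∀ k, m k = 0 → b k = 0)
    (θ₁ θ₂ : ℝ) (hirr : Irrational ((θ₁ - θ₂) / Real.pi))
    (h1 : ∀ t : ℝ, 0 < t →
      ∑' k, (a k * Complex.exp (-Complex.I * (m k : ℂ) * (θ₁ : ℂ)) +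
             b k * Complex.exp (Complex.I * (m k : ℂ) * (θ₁ : ℂ))) *
            (1 - Complex.exp (-(lam k : ℂ) * (t : ℂ))) = 0)
    (h2 : ∀ t : ℝ, 0 < t →
      ∑' k, (a k * Complex.exp (-Complex.I * (m k : ℂ) * (θ₂ : ℂ)) +
             b k * Complex.exp (Complex.I * (m k : ℂ) * (θ₂ : ℂ))) *
            (1 - Complex.exp (-(lam k : ℂ) * (t : ℂ))) = 0) :
    ∀ k, a k = 0 ∧ b k = 0 := by
  intro k
  have e1 := eq_zero_of_tsum_mul_one_sub_exp_neg_eq_zero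
    (summable_norm_angular_coeff ha hb m θ₁) hmono hpos h1 k
  have e2 := eq_zero_of_tsum_mul_one_sub_exp_neg_eq_zero
    (summable_norm_angular_coeff ha hb m θ₂) hmono hpos h2 k
  by_cases hm : m k = 0
  · exact ⟨by simpa [hm, hb0 k hm] using e1, hb0 k hm⟩
  · exact eq_zero_of_angular_coeff_eq_zero hm hirr e1 e2
end

section
/- Let λ : ℕ → ℝ satisfy 0 < λ n for every n, and let a : ℕ → ℂ satisfy Summable (fun n => ‖a n‖). Define F : ℝ → ℂ by F t = ∑' n, a n * (1 - Complex.exp (-(λ n) * t)). Then for every real t > 0, F has derivative ∑' n, a n * (λ n) * Complex.exp (-(λ n) * t) at t, i.e., HasDerivAt F (∑' n, a n * (λ n) * Complex.exp (-(λ n) * t)) t. -/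
theorem Real.mul_exp_neg_mul_le_inv {s : ℝ} (hs : 0 < s) (l : ℝ) :
    l * Real.exp (-l * s) ≤ s⁻¹ := by
  have h : l * s ≤ Real.exp (l * s) := by linarith [Real.add_one_le_exp (l * s)]
  rw [neg_mul, Real.exp_neg, ← div_eq_mul_inv, div_le_iff₀ (Real.exp_pos _),
    ← div_eq_inv_mul, le_div_iff₀ hs]
  exact h

theorem Complex.norm_exp_neg_ofReal_mul_ofReal (l s : ℝ) :
    ‖Complex.exp (-(l : ℂ) * (s : ℂ))‖ = Real.exp (-l * s) := by
  rw [Complex.norm_exp]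
  simp

theorem Complex.hasDerivAt_mul_one_sub_exp_neg_mul (c l : ℂ) (s : ℝ) :
    HasDerivAt (fun y : ℝ => c * (1 - Complex.exp (-l * (y : ℂ))))
      (c * l * Complex.exp (-l * (s : ℂ))) s := by
  have h : HasDerivAt (fun y : ℝ => -l * (y : ℂ)) (-l * 1) s :=
    (Complex.ofRealCLM.hasDerivAt (x := s)).const_mul (-l)
  refine ((h.cexp.const_sub 1).const_mul c).congr_deriv ?_
  ring

theorem flux_series_hasDerivAt
    (lam : ℕ → ℝ) (hlam : ∀ n, 0 < lam n)
    (a : ℕ → ℂ) (ha : Summable (fun n => ‖a n‖))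
    (F : ℝ → ℂ)
    (hF : ∀ t : ℝ, F t = ∑' n, a n * (1 - Complex.exp (-(lam n : ℂ) * (t : ℂ)))) :
    ∀ t : ℝ, 0 < t →
      HasDerivAt F
        (∑' n, a n * (lam n : ℂ) * Complex.exp (-(lam n : ℂ) * (t : ℂ))) t := by
  intro t ht
  rw [funext hF]
  have htwo : 0 < t / 2 := half_pos ht
  have hmem : t ∈ Set.Ioi (t / 2) := half_lt_self ht
  refine hasDerivAt_tsum_of_isPreconnected (ha.mul_right (t / 2)⁻¹) isOpen_Ioi
    isPreconnected_Ioi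
    (fun n s _ => Complex.hasDerivAt_mul_one_sub_exp_neg_mul (a n) (lam n) s) ?_ hmem ?_ hmem
  · intro n s hs
    have hs' : t / 2 < s := hs
    rw [mul_assoc, norm_mul, norm_mul, Complex.norm_exp_neg_ofReal_mul_ofReal,
      Complex.norm_of_nonneg (hlam n).le]
    gcongr
    exact (Real.mul_exp_neg_mul_le_inv (htwo.trans hs') (lam n)).trans (by gcongr)
  · refine .of_norm_bounded (ha.mul_right 2) fun n => ?_
    rw [norm_mul]
    gcongr
    refine (norm_sub_le _ _).trans ?_
    rw [norm_one, Complex.norm_exp_neg_ofReal_mul_ofReal]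
    have h : Real.exp (-lam n * t) ≤ 1 :=
      Real.exp_le_one_iff.mpr (by nlinarith [mul_pos (hlam n) ht])
    linarith
end
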